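/- Let Γ be a countable group, S a finite symmetric generating set of Γ with 1 ∉ S, and μ an ergodic Γ-invariant percolation on Ω = (Γ × Γ → Bool) with μ(Ω₁) > 0 and with indistinguishable infinite clusters. Let μ' be the degree-biased probability measure on Ω₁, for ω ∈ Ω₁ let P_ω be the law on Γ^ℕ of the simple random walk on C_ω(1) started at 1, let λ = ∫_{Ω₁} δ_ω ⊗ P_ω dμ'(ω) on Π = Ω₁ × Γ^ℕ, and let T(ω, (x_n)_n) = (x₁⁻¹ • ω, (x₁⁻¹ x_{n+1})_n). Then the system (Π, λ, T) is measure-preserving and ergodic: λ ∘ T⁻¹ = λ, and every Borel A ⊆ Π with T⁻¹A = A satisfies λ(A) ∈ {0, 1}. -/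

import Mathlib

open MeasureTheory Filter
open scoped ENNReal

/-- The cluster of the identity in the percolation configuration `ω`. -/
def percCluster {Γ : Type*} [Group Γ] (S : Finset Γ) (ω : Γ × Γ → Bool) : Set Γ :=
  {g | Relation.ReflTransGen (fun x y : Γ => x⁻¹ * y ∈ S ∧ ω (x, y) = true) 1 g}

/-- The event that the cluster of the identity is infinite. -/
def percOmega1 {Γ : Type*} [Group Γ] (S : Finset Γ) : Set (Γ × Γ → Bool) :=
  {ω | (percCluster S ω).Infinite}

/-- The degree of `x` in the configuration `ω`. -/
def percDeg {Γ : Type*} [Group Γ] [DecidableEq Γ] (S : Finset Γ) (ω : Γ × Γ → Bool)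
    (x : Γ) : ℕ :=
  (S.filter (fun s => ω (x, x * s) = true)).card

/-- One-step transition probability of the simple random walk on the configuration `ω`. -/
noncomputable def percStep {Γ : Type*} [Group Γ] [DecidableEq Γ] (S : Finset Γ)
    (ω : Γ × Γ → Bool) (x z : Γ) : ℝ≥0∞ :=
  if 0 < percDeg S ω x then
    (if x⁻¹ * z ∈ S ∧ ω (x, z) = true then ((percDeg S ω x : ℝ≥0∞))⁻¹ else 0)
  else (if z = x then 1 else 0)


section PercAux

set_option linter.unusedSectionVars false

variable {Γ : Type*} [Group Γ]

/-- `pAct k ω = k⁻¹ • ω`. -/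
def pAct (k : Γ) (ω : Γ × Γ → Bool) : Γ × Γ → Bool := fun q => ω (k * q.1, k * q.2)

/-- The `n`-step shift. -/
def pU (n : ℕ) (p : (Γ × Γ → Bool) × (ℕ → Γ)) : (Γ × Γ → Bool) × (ℕ → Γ) :=
  (pAct (p.2 n) p.1, fun k => (p.2 n)⁻¹ * p.2 (n + k))

/-- Cylinder. -/
def pCyl (n : ℕ) (y : ℕ → Γ) : Set (ℕ → Γ) := {x | ∀ i ≤ n, x i = y i}

lemma pAct_pAct (a b : Γ) (ω : Γ × Γ → Bool) : pAct a (pAct b ω) = pAct (b * a) ω := by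
  funext q; simp [pAct, mul_assoc]

lemma pAct_one (ω : Γ × Γ → Bool) : pAct 1 ω = ω := by
  funext q; simp [pAct]

lemma measurable_pAct (k : Γ) : Measurable (pAct k) := by
  refine measurable_pi_lambda _ fun q => measurable_pi_apply _

lemma pU_succ (n : ℕ) (p : (Γ × Γ → Bool) × (ℕ → Γ)) : pU n (pU 1 p) = pU (n + 1) p := by
  simp only [pU, pAct_pAct, Prod.mk.injEq]
  refine ⟨by rw [mul_inv_cancel_left, add_comm], ?_⟩
  funext k
  rw [mul_inv_rev, inv_inv, mul_assoc, mul_inv_cancel_left, add_comm 1 n, ← add_assoc,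
    show 1 + n + k = n + 1 + k by ring]

variable [DecidableEq Γ]

lemma percDeg_pAct (S : Finset Γ) (a : Γ) (ω : Γ × Γ → Bool) (x : Γ) :
    percDeg S (pAct a ω) x = percDeg S ω (a * x) := by
  simp only [percDeg, pAct, mul_assoc]
  congr!

lemma percStep_pAct (S : Finset Γ) (a : Γ) (ω : Γ × Γ → Bool) (x z : Γ) :
    percStep S (pAct a ω) x z = percStep S ω (a * x) (a * z) := by
  have : (a * x)⁻¹ * (a * z) = x⁻¹ * z := by group
  simp only [percStep, percDeg_pAct, this, mul_right_inj, pAct]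

variable [Countable Γ] [MeasurableSpace Γ] [MeasurableSingletonClass Γ]

lemma measurableSet_pCyl (n : ℕ) (y : ℕ → Γ) : MeasurableSet (pCyl n y) := by
  have : pCyl n y = ⋂ i, ⋂ (_ : i ≤ n), {x : ℕ → Γ | x i = y i} := by
    ext x; simp [pCyl]
  rw [this]
  exact MeasurableSet.iInter fun i => MeasurableSet.iInter fun _ =>
    (measurable_pi_apply (X := fun _ : ℕ => Γ) i) (measurableSet_singleton (y i))

lemma isPiSystem_pCyl : IsPiSystem {s : Set (ℕ → Γ) | ∃ n y, s = pCyl n y} := by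
  rintro _ ⟨n, y, rfl⟩ _ ⟨m, z, rfl⟩ ⟨w, hw1, hw2⟩
  refine ⟨max n m, w, ?_⟩
  ext x
  simp only [pCyl, Set.mem_inter_iff, Set.mem_ofPred_eq] at *
  constructor
  · rintro ⟨h1, h2⟩ i hi
    rcases le_max_iff.1 hi with h | h
    · rw [h1 i h, hw1 i h]
    · rw [h2 i h, hw2 i h]
  · intro h
    exact ⟨fun i hi => by rw [h i (le_max_of_le_left hi), hw1 i hi],
      fun i hi => by rw [h i (le_max_of_le_right hi), hw2 i hi]⟩

lemma generateFrom_pCyl : (MeasurableSpace.pi : MeasurableSpace (ℕ → Γ)) =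
    MeasurableSpace.generateFrom {s : Set (ℕ → Γ) | ∃ n y, s = pCyl n y} := by
  apply le_antisymm
  · refine iSup_le fun i => ?_
    rw [← measurable_iff_comap_le]
    refine @measurable_to_countable' _ _ _ _ (_) _ fun a => ?_
    have : (fun x : ℕ → Γ => x i) ⁻¹' {a} =
        ⋃ w : Fin i → Γ, pCyl i (fun j => if h : j < i then w ⟨j, h⟩ else a) := by
      ext x
      simp only [Set.mem_preimage, Set.mem_singleton_iff, Set.mem_iUnion, pCyl, Set.mem_ofPred_eq]
      constructor
      · intro h
        refine ⟨fun j => x j, fun j hj => ?_⟩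
        split_ifs with h'
        · rfl
        · rw [← h, le_antisymm hj (not_lt.1 h')]
      · rintro ⟨w, hw⟩
        simpa using hw i le_rfl
    rw [this]
    refine @MeasurableSet.iUnion _ _ (_) _ _ fun w => ?_
    exact MeasurableSpace.measurableSet_generateFrom ⟨_, _, rfl⟩
  · refine MeasurableSpace.generateFrom_le ?_
    rintro _ ⟨n, y, rfl⟩
    exact measurableSet_pCyl n y

lemma measurable_pAct_eval (n : ℕ) :
    Measurable (fun p : (Γ × Γ → Bool) × (ℕ → Γ) => pAct (p.2 n) p.1) := by
  have : Measurable (fun p : Γ × (Γ × Γ → Bool) => pAct p.1 p.2) :=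
    measurable_from_prod_countable_right (fun k => measurable_pAct k)
  have h2 : Measurable (fun p : (Γ × Γ → Bool) × (ℕ → Γ) => (p.2 n, p.1)) := by fun_prop
  exact this.comp h2

lemma measurable_pU (n : ℕ) : Measurable (pU n : (Γ × Γ → Bool) × (ℕ → Γ) → _) := by
  refine (measurable_pAct_eval n).prodMk ?_
  refine measurable_pi_lambda _ fun k => ?_
  have : Measurable (fun q : Γ × Γ => q.1⁻¹ * q.2) := measurable_of_countable _
  have h2 : Measurable (fun p : (Γ × Γ → Bool) × (ℕ → Γ) => (p.2 n, p.2 (n + k))) := by fun_prop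
  exact this.comp h2

/-- The defining property of the walk laws. -/
structure PWalk (S : Finset Γ) (P : (Γ × Γ → Bool) → Measure (ℕ → Γ)) : Prop where
  prob : ∀ ω, IsProbabilityMeasure (P ω)
  meas : Measurable P
  cyl : ∀ ω : Γ × Γ → Bool, ∀ n : ℕ, ∀ y : ℕ → Γ,
      P ω (pCyl n y) =
        (if y 0 = 1 then 1 else 0) * ∏ i ∈ Finset.range n, percStep S ω (y i) (y (i + 1))

variable {S : Finset Γ} {P : (Γ × Γ → Bool) → Measure (ℕ → Γ)}

lemma PWalk.markov_map (hP : PWalk S P) (ω : Γ × Γ → Bool) (n : ℕ) (y : ℕ → Γ) :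
    Measure.map (fun (x : ℕ → Γ) k => (y n)⁻¹ * x (n + k)) ((P ω).restrict (pCyl n y)) =
      P ω (pCyl n y) • P (pAct (y n) ω) := by
  have := hP.prob
  have hm : Measurable (fun (x : ℕ → Γ) k => (y n)⁻¹ * x (n + k)) := by
    refine measurable_pi_lambda _ fun k => ?_
    exact (measurable_of_countable (fun g : Γ => (y n)⁻¹ * g)).comp (measurable_pi_apply _)
  refine ext_of_generate_finite _ generateFrom_pCyl isPiSystem_pCyl ?_ ?_
  · rintro _ ⟨m, z, rfl⟩
    rw [Measure.map_apply hm (measurableSet_pCyl m z),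
      Measure.restrict_apply (hm (measurableSet_pCyl m z)), Measure.smul_apply, smul_eq_mul]
    by_cases hz : z 0 = 1
    · set w : ℕ → Γ := fun i => if i ≤ n then y i else y n * z (i - n) with hw
      have hw1 : ∀ i ≤ n, w i = y i := fun i hi => by simp [hw, hi]
      have hw2 : ∀ j, w (n + j) = y n * z j := fun j => by
        rcases Nat.eq_zero_or_pos j with rfl | hj
        · simp [hw, hz]
        · have : ¬ (n + j ≤ n) := by omega
          simp [hw, this]
      have hset : (fun (x : ℕ → Γ) k => (y n)⁻¹ * x (n + k)) ⁻¹' pCyl m z ∩ pCyl n y =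
          pCyl (n + m) w := by
        ext x
        simp only [pCyl, Set.mem_inter_iff, Set.mem_preimage, Set.mem_ofPred_eq]
        constructor
        · rintro ⟨h1, h2⟩ i hi
          rcases le_total i n with h | h
          · rw [hw1 i h, h2 i h]
          · obtain ⟨j, rfl⟩ := Nat.exists_eq_add_of_le h
            rw [hw2, ← h1 j (by omega), mul_inv_cancel_left]
        · intro h
          refine ⟨fun j hj => ?_, fun i hi => ?_⟩
          · rw [h _ (by omega), hw2, inv_mul_cancel_left]
          · rw [h _ (by omega), hw1 i hi]
      rw [hset, hP.cyl, hP.cyl, hP.cyl, Finset.prod_range_add, hw1 0 (Nat.zero_le _), if_pos hz,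
        one_mul, mul_assoc]
      congr 2
      · refine Finset.prod_congr rfl fun i hi => ?_
        have := Finset.mem_range.1 hi
        rw [hw1 i (by omega), hw1 (i + 1) (by omega)]
      · refine Finset.prod_congr rfl fun i hi => ?_
        rw [hw2, add_assoc, hw2, percStep_pAct]
    · have hset : (fun (x : ℕ → Γ) k => (y n)⁻¹ * x (n + k)) ⁻¹' pCyl m z ∩ pCyl n y = ∅ := by
        ext x
        simp only [pCyl, Set.mem_inter_iff, Set.mem_preimage, Set.mem_ofPred_eq,
          Set.mem_empty_iff_false, iff_false]
        rintro ⟨h1, h2⟩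
        apply hz
        rw [← h1 0 (Nat.zero_le _), add_zero, h2 n le_rfl, inv_mul_cancel]
      rw [hset, hP.cyl _ m z, if_neg hz]
      simp
  · rw [Measure.map_apply hm MeasurableSet.univ]
    simp

/-- Section probability. -/
noncomputable def pH (P : (Γ × Γ → Bool) → Measure (ℕ → Γ))
    (A : Set ((Γ × Γ → Bool) × (ℕ → Γ))) (ω : Γ × Γ → Bool) : ℝ≥0∞ :=
  P ω (Prod.mk ω ⁻¹' A)

lemma PWalk.markov_cyl (hP : PWalk S P) {A : Set ((Γ × Γ → Bool) × (ℕ → Γ))}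
    (hA : MeasurableSet A) (ω : Γ × Γ → Bool) (n : ℕ) (y : ℕ → Γ) :
    P ω (pCyl n y ∩ Prod.mk ω ⁻¹' (pU n ⁻¹' A)) = P ω (pCyl n y) * pH P A (pAct (y n) ω) := by
  have hm : Measurable (fun (x : ℕ → Γ) k => (y n)⁻¹ * x (n + k)) := by
    refine measurable_pi_lambda _ fun k => ?_
    exact (measurable_of_countable (fun g : Γ => (y n)⁻¹ * g)).comp (measurable_pi_apply _)
  have hA' : MeasurableSet (Prod.mk (pAct (y n) ω) ⁻¹' A) := measurable_prodMk_left hA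
  have h := congrArg (fun ν => ν (Prod.mk (pAct (y n) ω) ⁻¹' A)) (hP.markov_map ω n y)
  simp only [Measure.smul_apply, smul_eq_mul] at h
  rw [Measure.map_apply hm hA', Measure.restrict_apply (hm hA')] at h
  rw [pH, ← h]
  congr 1
  ext x
  simp only [Set.mem_inter_iff, Set.mem_preimage, pU]
  constructor
  · rintro ⟨h1, h2⟩
    rw [h1 n le_rfl] at h2
    exact ⟨h2, h1⟩
  · rintro ⟨h1, h2⟩
    rw [h2 n le_rfl]
    exact ⟨h2, h1⟩

/-- Restriction to the first coordinates. -/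
def pR (n : ℕ) (x : ℕ → Γ) : Fin (n + 1) → Γ := fun i => x i

lemma measurable_pR (n : ℕ) : Measurable (pR n : (ℕ → Γ) → _) :=
  measurable_pi_lambda _ fun _ => measurable_pi_apply _

lemma PWalk.measurable_pH (hP : PWalk S P) {A : Set ((Γ × Γ → Bool) × (ℕ → Γ))}
    (hA : MeasurableSet A) : Measurable (pH P A) := by
  have := hP.prob
  let κ : ProbabilityTheory.Kernel (Γ × Γ → Bool) (ℕ → Γ) := ⟨P, hP.meas⟩
  have : ProbabilityTheory.IsMarkovKernel κ := ⟨hP.prob⟩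
  exact ProbabilityTheory.Kernel.measurable_kernel_prodMk_left (κ := κ) hA

lemma PWalk.markov_set (hP : PWalk S P) {A : Set ((Γ × Γ → Bool) × (ℕ → Γ))}
    (hA : MeasurableSet A) (ω : Γ × Γ → Bool) (n : ℕ) (C : Set (Fin (n + 1) → Γ)) :
    P ω (pR n ⁻¹' C ∩ Prod.mk ω ⁻¹' (pU n ⁻¹' A)) =
      ∫⁻ x in pR n ⁻¹' C, pH P A (pAct (x n) ω) ∂(P ω) := by
  have hA' : MeasurableSet (Prod.mk ω ⁻¹' (pU n ⁻¹' A)) :=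
    measurable_prodMk_left (measurable_pU n hA)
  have hf : Measurable (fun w : Fin (n + 1) → Γ => pH P A (pAct (w (Fin.last n)) ω)) :=
    measurable_of_countable _
  have hC : MeasurableSet C := C.to_countable.measurableSet
  have key : Measure.map (pR n) ((P ω).restrict (Prod.mk ω ⁻¹' (pU n ⁻¹' A))) =
      ((P ω).map (pR n)).withDensity (fun w => pH P A (pAct (w (Fin.last n)) ω)) := by
    refine Measure.ext_of_singleton fun w => ?_
    have hw : MeasurableSet ({w} : Set (Fin (n + 1) → Γ)) := measurableSet_singleton w
    set y : ℕ → Γ := fun i => if h : i < n + 1 then w ⟨i, h⟩ else 1 with hy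
    have hset : pR n ⁻¹' {w} = pCyl n y := by
      ext x
      simp only [Set.mem_preimage, Set.mem_singleton_iff, pCyl, Set.mem_ofPred_eq]
      constructor
      · rintro rfl i hi
        simp only [hy, pR, Nat.lt_succ_of_le hi, dif_pos]
      · intro h
        funext i
        simp only [pR, h i (Nat.lt_succ_iff.1 i.2), hy, i.2, dif_pos]
    have hyn : y n = w (Fin.last n) := by simp [hy, Fin.last]
    rw [Measure.map_apply (measurable_pR n) hw, Measure.restrict_apply (measurable_pR n hw),
      withDensity_apply _ hw, Measure.restrict_singleton, lintegral_smul_measure,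
      lintegral_dirac, Measure.map_apply (measurable_pR n) hw, hset, hP.markov_cyl hA, hyn,
      smul_eq_mul]
  have h := congrArg (fun ν => ν C) key
  rw [Measure.map_apply (measurable_pR n) hC, Measure.restrict_apply (measurable_pR n hC),
    withDensity_apply _ hC, setLIntegral_map hC hf (measurable_pR n)] at h
  exact h

end PercAux

section PercAux2

set_option linter.unusedSectionVars false

variable {Γ : Type*} [Group Γ] [DecidableEq Γ] [Countable Γ]

/-- Reachability in `n` steps. -/
def pReach (S : Finset Γ) (ω : Γ × Γ → Bool) : ℕ → Γ → Prop
  | 0, g => g = 1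
  | n + 1, g => ∃ x, pReach S ω n x ∧ x⁻¹ * g ∈ S ∧ ω (x, g) = true

lemma mem_percCluster_iff (S : Finset Γ) (ω : Γ × Γ → Bool) (g : Γ) :
    g ∈ percCluster S ω ↔ ∃ n, pReach S ω n g := by
  constructor
  · intro h
    change Relation.ReflTransGen _ 1 g at h
    induction h with
    | refl => exact ⟨0, rfl⟩
    | tail _ h2 ih =>
      obtain ⟨n, hn⟩ := ih
      exact ⟨n + 1, _, hn, h2⟩
  · rintro ⟨n, hn⟩
    change Relation.ReflTransGen _ 1 g
    induction n generalizing g with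
    | zero => rw [show g = 1 from hn]
    | succ n ih =>
      obtain ⟨x, hx, h2⟩ := hn
      exact (ih x hx).tail h2

lemma measurableSet_coord (q : Γ × Γ) :
    MeasurableSet {ω : Γ × Γ → Bool | ω q = true} :=
  (measurable_pi_apply (X := fun _ : Γ × Γ => Bool) q) (measurableSet_singleton true)

lemma measurableSet_pReach (S : Finset Γ) (n : ℕ) (g : Γ) :
    MeasurableSet {ω : Γ × Γ → Bool | pReach S ω n g} := by
  induction n generalizing g with
  | zero => exact MeasurableSet.const _
  | succ n ih =>
    have : {ω : Γ × Γ → Bool | pReach S ω (n + 1) g} =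
        ⋃ x, {ω | pReach S ω n x} ∩ ({ω | x⁻¹ * g ∈ S} ∩ {ω | ω (x, g) = true}) := by
      ext ω
      simp [pReach]
    rw [this]
    exact MeasurableSet.iUnion fun x => (ih x).inter
      ((MeasurableSet.const _).inter (measurableSet_coord _))

lemma measurableSet_percOmega1 (S : Finset Γ) :
    MeasurableSet (percOmega1 S : Set (Γ × Γ → Bool)) := by
  have h1 : ∀ g : Γ, MeasurableSet {ω : Γ × Γ → Bool | g ∈ percCluster S ω} := fun g => by
    have : {ω : Γ × Γ → Bool | g ∈ percCluster S ω} = ⋃ n, {ω | pReach S ω n g} := by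
      ext ω
      simp [mem_percCluster_iff]
    rw [this]
    exact MeasurableSet.iUnion fun n => measurableSet_pReach S n g
  have h2 : (percOmega1 S : Set (Γ × Γ → Bool))ᶜ =
      ⋃ F : Finset Γ, ⋂ g, ⋂ (_ : g ∉ F), {ω : Γ × Γ → Bool | g ∈ percCluster S ω}ᶜ := by
    ext ω
    simp only [percOmega1, Set.mem_compl_iff, Set.mem_ofPred_eq, Set.not_infinite, Set.mem_iUnion,
      Set.mem_iInter]
    constructor
    · intro h
      exact ⟨h.toFinset, fun g hg hg' => hg (h.mem_toFinset.2 hg')⟩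
    · rintro ⟨F, hF⟩
      refine F.finite_toSet.subset fun g hg => ?_
      by_contra h
      exact hF g h hg
  rw [← MeasurableSet.compl_iff, h2]
  exact MeasurableSet.iUnion fun F => MeasurableSet.iInter fun g =>
    MeasurableSet.iInter fun _ => (h1 g).compl

lemma percOmega1_of_pAct {S : Finset Γ} {ω : Γ × Γ → Bool} {s : Γ} (hs : s ∈ S)
    (h : ω (1, s) = true) (h1 : pAct s ω ∈ percOmega1 S) : ω ∈ percOmega1 S := by
  change (percCluster S (pAct s ω)).Infinite at h1
  change (percCluster S ω).Infinite
  refine (h1.image (f := fun g => s * g) (fun a _ b _ hab => mul_left_cancel hab)).mono ?_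
  rintro _ ⟨g, hg, rfl⟩
  change Relation.ReflTransGen _ 1 (s * g)
  change Relation.ReflTransGen _ 1 g at hg
  induction hg with
  | refl => exact Relation.ReflTransGen.single ⟨by simpa using hs, by simpa using h⟩
  | @tail b c _ h2 ih =>
    refine ih.tail ⟨?_, h2.2⟩
    have : (s * b)⁻¹ * (s * c) = b⁻¹ * c := by group
    rw [this]; exact h2.1

/-- symmetric configurations -/
def pSym : Set (Γ × Γ → Bool) := {ω | ∀ x y : Γ, ω (x, y) = ω (y, x)}

lemma pSym_pAct {ω : Γ × Γ → Bool} (h : ω ∈ (pSym : Set (Γ × Γ → Bool))) (a : Γ) :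
    pAct a ω ∈ (pSym : Set (Γ × Γ → Bool)) := fun _ _ => h _ _

lemma measurableSet_pSym : MeasurableSet (pSym : Set (Γ × Γ → Bool)) := by
  have : (pSym : Set (Γ × Γ → Bool)) = ⋂ x, ⋂ y, {ω | ω (x, y) = ω (y, x)} := by
    ext; simp [pSym]
  rw [this]
  exact MeasurableSet.iInter fun x => MeasurableSet.iInter fun y =>
    measurableSet_eq_fun (measurable_pi_apply _) (measurable_pi_apply _)

lemma percOmega1_iff_pAct {S : Finset Γ} (hS : ∀ s ∈ S, s⁻¹ ∈ S) {ω : Γ × Γ → Bool}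
    (hω : ω ∈ (pSym : Set (Γ × Γ → Bool))) {s : Γ}
    (hs : s ∈ S) (h : ω (1, s) = true) : pAct s ω ∈ percOmega1 S ↔ ω ∈ percOmega1 S := by
  refine ⟨percOmega1_of_pAct hs h, fun h1 => ?_⟩
  refine percOmega1_of_pAct (hS s hs) ?_ (by rwa [pAct_pAct, mul_inv_cancel, pAct_one])
  simp only [pAct, mul_one, mul_inv_cancel]
  rw [hω]; exact h

lemma percDeg_pos {S : Finset Γ} {ω : Γ × Γ → Bool} (h : ω ∈ percOmega1 S) :
    0 < percDeg S ω 1 := by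
  have h' : (percCluster S ω).Infinite := h
  have : ∃ g ∈ percCluster S ω, g ≠ 1 := by
    by_contra hc
    push Not at hc
    exact h' ((Set.finite_singleton (1 : Γ)).subset hc)
  obtain ⟨g, hg, hg1⟩ := this
  change Relation.ReflTransGen _ 1 g at hg
  rcases Relation.ReflTransGen.cases_head hg with h | ⟨c, hc, -⟩
  · exact absurd h.symm hg1
  · refine Finset.card_pos.2 ⟨c, ?_⟩
    simpa using hc

lemma percDeg_eq_sum (S : Finset Γ) (ω : Γ × Γ → Bool) :
    (percDeg S ω 1 : ℝ≥0∞) = ∑ s ∈ S, if ω (1, s) = true then 1 else 0 := by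
  rw [percDeg]
  simp

lemma measurable_percDeg (S : Finset Γ) :
    Measurable (fun ω : Γ × Γ → Bool => (percDeg S ω 1 : ℝ≥0∞)) := by
  simp only [percDeg_eq_sum]
  exact Finset.measurable_fun_sum _ fun s _ =>
    Measurable.ite (measurableSet_coord _) measurable_const measurable_const

variable [MeasurableSpace Γ] [MeasurableSingletonClass Γ]
variable {S : Finset Γ} {P : (Γ × Γ → Bool) → Measure (ℕ → Γ)}

lemma PWalk.step_law (hP : PWalk S P) (ω : Γ × Γ → Bool) (z : Γ) :
    P ω ((fun x : ℕ → Γ => x 1) ⁻¹' {z}) = percStep S ω 1 z := by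
  have := hP.prob
  have h0 : P ω (pCyl 0 (fun _ => 1)) = 1 := by rw [hP.cyl]; simp
  have h1 := hP.cyl ω 1 (fun i => if i = 0 then 1 else z)
  simp only [if_true, one_mul, Finset.prod_range_one, zero_add, one_ne_zero, if_false] at h1
  rw [← h1]
  have hae : ∀ᵐ x ∂(P ω), x ∈ pCyl 0 (fun _ => (1 : Γ)) :=
    (prob_compl_eq_zero_iff (measurableSet_pCyl 0 _)).2 h0
  refine measure_congr ?_
  filter_upwards [hae] with x hx
  have hx0 : x 0 = 1 := hx 0 le_rfl
  apply propext
  change x 1 = z ↔ ∀ i ≤ 1, x i = _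
  constructor
  · intro h i hi
    interval_cases i <;> simp [h, hx0]
  · intro h
    simpa using h 1 le_rfl

lemma PWalk.lintegral_step (hP : PWalk S P) {ω : Γ × Γ → Bool} (hω : 0 < percDeg S ω 1)
    (f : Γ → ℝ≥0∞) :
    ∫⁻ x, f (x 1) ∂(P ω) =
      ∑ s ∈ S, (if ω (1, s) = true then (percDeg S ω 1 : ℝ≥0∞)⁻¹ else 0) * f s := by
  have hm : Measurable (fun x : ℕ → Γ => x 1) := measurable_pi_apply _
  rw [← lintegral_map (f := f) (measurable_of_countable f) hm, lintegral_countable',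
    tsum_eq_sum (s := S)]
  · refine Finset.sum_congr rfl fun s hs => ?_
    rw [Measure.map_apply hm (measurableSet_singleton s), hP.step_law, percStep, if_pos hω,
      mul_comm]
    simp [hs]
  · intro s hs
    rw [Measure.map_apply hm (measurableSet_singleton s), hP.step_law, percStep, if_pos hω]
    simp [hs]

lemma pMuInv (hS : ∀ s ∈ S, s⁻¹ ∈ S) (hP : PWalk S P) (μ : Measure (Γ × Γ → Bool))
    (hinv : ∀ g : Γ, μ.map (pAct g) = μ) (hsym : ∀ᵐ ω ∂μ, ω ∈ (pSym : Set (Γ × Γ → Bool)))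
    (c : ℝ≥0∞) (f : (Γ × Γ → Bool) → ℝ≥0∞) (hf : Measurable f) :
    ∫⁻ ω in percOmega1 S, (percDeg S ω 1 * c) * ∫⁻ x, f (pAct (x 1) ω) ∂(P ω) ∂μ =
      ∫⁻ ω in percOmega1 S, (percDeg S ω 1 * c) * f ω ∂μ := by
  have hO := measurableSet_percOmega1 (Γ := Γ) S
  set k : Γ → (Γ × Γ → Bool) → ℝ≥0∞ := fun s =>
    (percOmega1 S ∩ {ω | ω (1, s) = true}).indicator (fun _ => c) with hk
  have hkm : ∀ s, Measurable (k s) := fun s =>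
    measurable_const.indicator (hO.inter (measurableSet_coord _))
  have hL : ∀ ω, (percOmega1 S).indicator
      (fun ω => (percDeg S ω 1 * c) * ∫⁻ x, f (pAct (x 1) ω) ∂(P ω)) ω =
      ∑ s ∈ S, k s ω * f (pAct s ω) := fun ω => by
    by_cases hω : ω ∈ percOmega1 S
    · have hd := percDeg_pos hω
      rw [Set.indicator_of_mem hω, hP.lintegral_step hd (fun z => f (pAct z ω)), Finset.mul_sum]
      refine Finset.sum_congr rfl fun s _ => ?_
      by_cases h : ω (1, s) = true
      · have h2 : ω ∈ percOmega1 S ∩ {ω | ω (1, s) = true} := ⟨hω, h⟩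
        rw [if_pos h, hk]
        simp only [Set.indicator_of_mem h2]
        have h3 : (percDeg S ω 1 : ℝ≥0∞) * (percDeg S ω 1 : ℝ≥0∞)⁻¹ = 1 :=
          ENNReal.mul_inv_cancel (by exact_mod_cast hd.ne') (ENNReal.natCast_ne_top _)
        calc _ = ((percDeg S ω 1 : ℝ≥0∞) * (percDeg S ω 1 : ℝ≥0∞)⁻¹) * (c * f (pAct s ω)) := by ring
          _ = _ := by rw [h3, one_mul]
      · have h2 : ω ∉ percOmega1 S ∩ {ω | ω (1, s) = true} := fun h3 => h h3.2
        rw [if_neg h, hk]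
        simp only [Set.indicator_of_notMem h2]
        simp
    · rw [Set.indicator_of_notMem hω]
      symm
      refine Finset.sum_eq_zero fun s _ => ?_
      have h2 : ω ∉ percOmega1 S ∩ {ω | ω (1, s) = true} := fun h3 => hω h3.1
      simp only [hk, Set.indicator_of_notMem h2, zero_mul]
  have hR : ∀ ω, (percOmega1 S).indicator (fun ω => (percDeg S ω 1 * c) * f ω) ω =
      ∑ s ∈ S, k s ω * f ω := fun ω => by
    by_cases hω : ω ∈ percOmega1 S
    · rw [Set.indicator_of_mem hω, percDeg_eq_sum, Finset.sum_mul, Finset.sum_mul]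
      refine Finset.sum_congr rfl fun s _ => ?_
      by_cases h : ω (1, s) = true
      · have h2 : ω ∈ percOmega1 S ∩ {ω | ω (1, s) = true} := ⟨hω, h⟩
        rw [if_pos h, hk]
        simp only [Set.indicator_of_mem h2, one_mul]
      · have h2 : ω ∉ percOmega1 S ∩ {ω | ω (1, s) = true} := fun h3 => h h3.2
        rw [if_neg h, hk]
        simp only [Set.indicator_of_notMem h2, zero_mul]
    · rw [Set.indicator_of_notMem hω]
      symm
      refine Finset.sum_eq_zero fun s _ => ?_
      have h2 : ω ∉ percOmega1 S ∩ {ω | ω (1, s) = true} := fun h3 => hω h3.1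
      simp only [hk, Set.indicator_of_notMem h2, zero_mul]
  rw [← lintegral_indicator hO, ← lintegral_indicator hO]
  simp only [hL, hR]
  have m1 : ∀ s ∈ S, Measurable (fun ω => k s ω * f (pAct s ω)) :=
    fun s _ => (hkm s).mul (hf.comp (measurable_pAct s))
  have m2 : ∀ s ∈ S, Measurable (fun ω => k s ω * f ω) := fun s _ => (hkm s).mul hf
  rw [lintegral_finsetSum _ m1, lintegral_finsetSum _ m2]
  have step : ∀ s ∈ S, ∫⁻ ω, k s ω * f (pAct s ω) ∂μ = ∫⁻ ω, k s⁻¹ ω * f ω ∂μ := by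
    intro s hs
    have e1 : ∫⁻ ω, k s ω * f (pAct s ω) ∂μ =
        ∫⁻ ω, (fun ω => k s (pAct s⁻¹ ω) * f ω) (pAct s ω) ∂μ := by
      simp only [pAct_pAct, mul_inv_cancel, pAct_one]
    have m3 : Measurable (fun ω => k s (pAct s⁻¹ ω) * f ω) :=
      ((hkm s).comp (measurable_pAct _)).mul hf
    rw [e1, ← lintegral_map m3 (measurable_pAct s), hinv]
    refine lintegral_congr_ae ?_
    filter_upwards [hsym] with ω hω
    have : pAct s⁻¹ ω ∈ percOmega1 S ∩ {ω | ω (1, s) = true} ↔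
        ω ∈ percOmega1 S ∩ {ω | ω (1, s⁻¹) = true} := by
      have h3 : pAct s⁻¹ ω (1, s) = ω (1, s⁻¹) := by
        simp only [pAct, mul_one, inv_mul_cancel]; exact hω _ _
      simp only [Set.mem_inter_iff, Set.mem_ofPred_eq, h3]
      refine and_congr_left fun h => ?_
      exact percOmega1_iff_pAct hS hω (hS s hs) h
    simp only [hk]
    congr 1
    by_cases h : ω ∈ percOmega1 S ∩ {ω | ω (1, s⁻¹) = true}
    · rw [Set.indicator_of_mem h, Set.indicator_of_mem (this.2 h)]
    · rw [Set.indicator_of_notMem h, Set.indicator_of_notMem (fun h' => h (this.1 h'))]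
  rw [Finset.sum_congr rfl step]
  exact Finset.sum_nbij' (fun s => s⁻¹) (fun s => s⁻¹) hS hS (fun _ _ => inv_inv _)
    (fun _ _ => inv_inv _) (fun _ _ => rfl)

end PercAux2

section PercAux3

set_option linter.unusedSectionVars false

variable {Γ : Type*} [Group Γ] [DecidableEq Γ] [Countable Γ]
variable [MeasurableSpace Γ] [MeasurableSingletonClass Γ]
variable {S : Finset Γ} {P : (Γ × Γ → Bool) → Measure (ℕ → Γ)}

/-- Restriction on the bundle. -/
def pRR (n : ℕ) (p : (Γ × Γ → Bool) × (ℕ → Γ)) : (Γ × Γ → Bool) × (Fin (n + 1) → Γ) :=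
  (p.1, pR n p.2)

lemma measurable_pRR (n : ℕ) : Measurable (pRR n : (Γ × Γ → Bool) × (ℕ → Γ) → _) :=
  measurable_fst.prodMk ((measurable_pR n).comp measurable_snd)

/-- Algebra of finitely determined sets. -/
def pAlg : Set (Set ((Γ × Γ → Bool) × (ℕ → Γ))) :=
  {C | ∃ n, ∃ C' : Set ((Γ × Γ → Bool) × (Fin (n + 1 + 1) → Γ)), MeasurableSet C' ∧
    C = pRR (n + 1) ⁻¹' C'}

lemma pAlg_mono {n m : ℕ} (h : n ≤ m) (C' : Set ((Γ × Γ → Bool) × (Fin (n + 1 + 1) → Γ)))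
    (hC : MeasurableSet C') :
    ∃ C'' : Set ((Γ × Γ → Bool) × (Fin (m + 1 + 1) → Γ)), MeasurableSet C'' ∧
      pRR (n + 1) ⁻¹' C' = pRR (m + 1) ⁻¹' C'' := by
  have hm : Measurable (fun q : (Γ × Γ → Bool) × (Fin (m + 1 + 1) → Γ) =>
      (q.1, fun i : Fin (n + 1 + 1) => q.2 (Fin.castLE (by omega) i))) :=
    measurable_fst.prodMk (measurable_pi_lambda _ fun i =>
      (measurable_pi_apply _).comp measurable_snd)
  exact ⟨_, hm hC, rfl⟩

lemma isSetRing_pAlg : IsSetRing (pAlg : Set (Set ((Γ × Γ → Bool) × (ℕ → Γ)))) where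
  empty_mem := ⟨0, ∅, MeasurableSet.empty, rfl⟩
  union_mem := by
    rintro _ _ ⟨n, C, hC, rfl⟩ ⟨m, E, hE, rfl⟩
    obtain ⟨C', hC', e1⟩ := pAlg_mono (le_max_left n m) C hC
    obtain ⟨E', hE', e2⟩ := pAlg_mono (le_max_right n m) E hE
    exact ⟨max n m, C' ∪ E', hC'.union hE', by rw [e1, e2]; rfl⟩
  sdiff_mem := by
    rintro _ _ ⟨n, C, hC, rfl⟩ ⟨m, E, hE, rfl⟩
    obtain ⟨C', hC', e1⟩ := pAlg_mono (le_max_left n m) C hC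
    obtain ⟨E', hE', e2⟩ := pAlg_mono (le_max_right n m) E hE
    exact ⟨max n m, C' \ E', hC'.diff hE', by rw [e1, e2]; rfl⟩

lemma generateFrom_pAlg : (Prod.instMeasurableSpace : MeasurableSpace ((Γ × Γ → Bool) × (ℕ → Γ))) =
    MeasurableSpace.generateFrom pAlg := by
  apply le_antisymm
  · refine sup_le ?_ ?_
    · rintro _ ⟨B, hB, rfl⟩
      exact MeasurableSpace.measurableSet_generateFrom ⟨0, Prod.fst ⁻¹' B, measurable_fst hB, rfl⟩
    · rw [← measurable_iff_comap_le]
      refine @measurable_pi_lambda _ _ _ (_) _ _ fun i => ?_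
      intro E hE
      refine MeasurableSpace.measurableSet_generateFrom
        ⟨i, (fun q => q.2 ⟨i, by omega⟩) ⁻¹' E, ?_, rfl⟩
      exact ((measurable_pi_apply _).comp measurable_snd) hE
  · refine MeasurableSpace.generateFrom_le ?_
    rintro _ ⟨n, C, hC, rfl⟩
    exact measurable_pRR _ hC

lemma pU_preimage {A : Set ((Γ × Γ → Bool) × (ℕ → Γ))} (h : pU 1 ⁻¹' A = A) (n : ℕ) :
    pU (n + 1) ⁻¹' A = A := by
  induction n with
  | zero => exact h
  | succ n ih =>
    have : (pU (n + 1 + 1) : (Γ × Γ → Bool) × (ℕ → Γ) → _) = pU (n + 1) ∘ pU 1 :=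
      funext fun p => (pU_succ (n + 1) p).symm
    rw [this, Set.preimage_comp, ih, h]

lemma pU_mp {lam : Measure ((Γ × Γ → Bool) × (ℕ → Γ))} (h : MeasurePreserving (pU 1) lam lam)
    (n : ℕ) : MeasurePreserving (pU (n + 1)) lam lam := by
  induction n with
  | zero => exact h
  | succ n ih =>
    have : (pU (n + 1 + 1) : (Γ × Γ → Bool) × (ℕ → Γ) → _) = pU (n + 1) ∘ pU 1 :=
      funext fun p => (pU_succ (n + 1) p).symm
    rw [this]
    exact ih.comp h

lemma PWalk.markov_lam (hP : PWalk S P) {lam : Measure ((Γ × Γ → Bool) × (ℕ → Γ))}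
    {μ' : Measure (Γ × Γ → Bool)}
    (hlam : ∀ F : (Γ × Γ → Bool) × (ℕ → Γ) → ℝ≥0∞, Measurable F →
      ∫⁻ p, F p ∂lam = ∫⁻ ω, ∫⁻ x, F (ω, x) ∂(P ω) ∂μ')
    {A : Set ((Γ × Γ → Bool) × (ℕ → Γ))} (hA : MeasurableSet A) (n : ℕ)
    {C' : Set ((Γ × Γ → Bool) × (Fin (n + 1) → Γ))} (hC : MeasurableSet C') :
    lam (pRR n ⁻¹' C' ∩ pU n ⁻¹' A) =
      ∫⁻ p in pRR n ⁻¹' C', pH P A (pU n p).1 ∂lam := by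
  have hC1 := measurable_pRR n hC
  have hA1 := measurable_pU n hA
  have hh : Measurable (fun p : (Γ × Γ → Bool) × (ℕ → Γ) => pH P A (pU n p).1) :=
    (hP.measurable_pH hA).comp (measurable_fst.comp (measurable_pU n))
  rw [← lintegral_indicator_one (hC1.inter hA1), ← lintegral_indicator hC1,
    hlam _ (measurable_one.indicator (hC1.inter hA1)), hlam _ (hh.indicator hC1)]
  refine lintegral_congr fun ω => ?_
  have hC2 : MeasurableSet (pR n ⁻¹' (Prod.mk ω ⁻¹' C')) :=
    measurable_pR n (measurable_prodMk_left hC)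
  have hA2 : MeasurableSet (Prod.mk ω ⁻¹' (pU n ⁻¹' A)) := measurable_prodMk_left hA1
  have h := hP.markov_set hA ω n (Prod.mk ω ⁻¹' C')
  rw [← lintegral_indicator_one (hC2.inter hA2), ← lintegral_indicator hC2] at h
  exact h

lemma PWalk.zero_one (hP : PWalk S P) {lam : Measure ((Γ × Γ → Bool) × (ℕ → Γ))}
    [IsProbabilityMeasure lam] {μ' : Measure (Γ × Γ → Bool)}
    (hlam : ∀ F : (Γ × Γ → Bool) × (ℕ → Γ) → ℝ≥0∞, Measurable F →
      ∫⁻ p, F p ∂lam = ∫⁻ ω, ∫⁻ x, F (ω, x) ∂(P ω) ∂μ')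
    (hmp : MeasurePreserving (pU 1) lam lam)
    {A : Set ((Γ × Γ → Bool) × (ℕ → Γ))} (hA : MeasurableSet A) (hAT : pU 1 ⁻¹' A = A) :
    ∫⁻ ω, pH P A ω * pH P Aᶜ ω ∂μ' = 0 := by
  have := hP.prob
  have hh := hP.measurable_pH hA
  have hg := hP.measurable_pH hA.compl
  have hh1 : ∀ ω, pH P A ω ≤ 1 := fun ω => prob_le_one
  have hg1 : ∀ ω, pH P Aᶜ ω ≤ 1 := fun ω => prob_le_one
  refine le_antisymm (le_of_forall_pos_le_add fun ε hε => ?_) zero_le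
  rw [zero_add]
  obtain ⟨C, ⟨n, C', hC', rfl⟩, hC⟩ := exists_measure_symmDiff_lt_of_generateFrom_isSetRing
    (μ := lam) (isSetRing_pAlg (Γ := Γ))
    ⟨{Set.univ}, Set.countable_singleton _,
      Set.singleton_subset_iff.2 ⟨0, Set.univ, MeasurableSet.univ, rfl⟩, by simp⟩
    generateFrom_pAlg hA hε
  refine le_trans ?_ hC.le
  have hC1 := measurable_pRR (n + 1) hC'
  have mm : Measurable (fun p : (Γ × Γ → Bool) × (ℕ → Γ) => pH P A p.1 * pH P Aᶜ p.1) :=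
    (hh.comp measurable_fst).mul (hg.comp measurable_fst)
  have e1 : ∫⁻ ω, pH P A ω * pH P Aᶜ ω ∂μ' = ∫⁻ p, pH P A p.1 * pH P Aᶜ p.1 ∂lam := by
    rw [hlam _ mm]
    simp
  rw [e1, ← (pU_mp hmp n).lintegral_comp mm, ← lintegral_add_compl _ hC1, symmDiff_def,
    show (pRR (n + 1) ⁻¹' C' \ A ⊔ A \ pRR (n + 1) ⁻¹' C') =
      (pRR (n + 1) ⁻¹' C' \ A) ∪ (A \ pRR (n + 1) ⁻¹' C') from rfl,
    measure_union (disjoint_sdiff_sdiff) (hA.diff hC1)]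
  refine add_le_add ?_ ?_
  · calc _ ≤ ∫⁻ p in pRR (n + 1) ⁻¹' C', pH P Aᶜ (pU (n + 1) p).1 ∂lam :=
        lintegral_mono fun p => mul_le_of_le_one_left zero_le (hh1 _)
      _ = lam (pRR (n + 1) ⁻¹' C' ∩ pU (n + 1) ⁻¹' Aᶜ) :=
        (hP.markov_lam hlam hA.compl (n + 1) hC').symm
      _ = _ := by rw [Set.preimage_compl, pU_preimage hAT]; rfl
  · calc _ ≤ ∫⁻ p in (pRR (n + 1) ⁻¹' C')ᶜ, pH P A (pU (n + 1) p).1 ∂lam :=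
        lintegral_mono fun p => mul_le_of_le_one_right zero_le (hg1 _)
      _ = lam (pRR (n + 1) ⁻¹' C'ᶜ ∩ pU (n + 1) ⁻¹' A) :=
        (hP.markov_lam hlam hA (n + 1) hC'.compl).symm
      _ = _ := by rw [pU_preimage hAT, Set.inter_comm]; rfl

lemma PWalk.harm (hP : PWalk S P) {A : Set ((Γ × Γ → Bool) × (ℕ → Γ))} (hA : MeasurableSet A)
    (hAT : pU 1 ⁻¹' A = A) {ω : Γ × Γ → Bool} {s : Γ} (hs : s ∈ S) (h : ω (1, s) = true)
    (h0 : pH P A ω = 0) : pH P A (pAct s ω) = 0 := by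
  have hd : 0 < percDeg S ω 1 := Finset.card_pos.2 ⟨s, by simp [hs, h]⟩
  have h1 := hP.markov_cyl hA ω 1 (fun i => if i = 0 then 1 else s)
  rw [hAT, measure_mono_null Set.inter_subset_right h0, hP.cyl] at h1
  simp only [if_true, one_mul, Finset.prod_range_one, zero_add, one_ne_zero, if_false] at h1
  have h2 : percStep S ω 1 s ≠ 0 := by
    simp [percStep, hd, hs, h]
  exact (mul_eq_zero.1 h1.symm).resolve_left h2

lemma PWalk.harm_path (hP : PWalk S P) {A : Set ((Γ × Γ → Bool) × (ℕ → Γ))} (hA : MeasurableSet A)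
    (hS : ∀ s ∈ S, s⁻¹ ∈ S)
    (hAT : pU 1 ⁻¹' A = A) {ω : Γ × Γ → Bool} (hω : ω ∈ (pSym : Set (Γ × Γ → Bool))) {k : Γ}
    (hk : k ∈ percCluster S ω)
    (h0 : pH P A (pAct k ω) = 0) : pH P A ω = 0 := by
  change Relation.ReflTransGen _ 1 k at hk
  induction hk with
  | refl => rwa [pAct_one] at h0
  | @tail b c _ h2 ih =>
    apply ih
    have h3 : b⁻¹ * c ∈ S := h2.1
    have h4 : c⁻¹ * b ∈ S := by simpa using hS _ h3
    have := hP.harm hA hAT h4 (ω := pAct c ω) (by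
      simp only [pAct, mul_one, mul_inv_cancel_left]
      rw [hω]; exact h2.2) h0
    rwa [pAct_pAct, mul_inv_cancel_left] at this

end PercAux3
/-- Theorem 5.5: for an ergodic invariant percolation with
indistinguishable infinite clusters, the shift `T` on the path bundle is measure
preserving and ergodic. -/
theorem stmt_12 {Γ : Type*} [Group Γ] [Countable Γ] [DecidableEq Γ]
    [MeasurableSpace Γ] [MeasurableSingletonClass Γ]
    (S : Finset Γ) (hS1 : (1 : Γ) ∉ S) (hSsymm : ∀ s ∈ S, s⁻¹ ∈ S)
    (hSgen : Subgroup.closure (S : Set Γ) = ⊤)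
    (μ : Measure (Γ × Γ → Bool)) [IsProbabilityMeasure μ]
    (hinv : ∀ g : Γ,
      Measure.map (fun (ω : Γ × Γ → Bool) (p : Γ × Γ) => ω (g⁻¹ * p.1, g⁻¹ * p.2)) μ = μ)
    (herg : ∀ A : Set (Γ × Γ → Bool), MeasurableSet A →
      (∀ g : Γ, (fun (ω : Γ × Γ → Bool) (p : Γ × Γ) => ω (g⁻¹ * p.1, g⁻¹ * p.2)) ⁻¹' A = A) →
      μ A = 0 ∨ μ A = 1)
    (hsymm : ∀ᵐ ω ∂μ, ∀ x y : Γ, ω (x, y) = ω (y, x))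
    (hpos : 0 < μ (percOmega1 S))
    -- indistinguishability of infinite clusters:
    (hind : ∀ A : Set (Γ × Γ → Bool), MeasurableSet A → A ⊆ percOmega1 S →
      A = {ω ∈ percOmega1 S | ∃ g : Γ, g⁻¹ ∈ percCluster S ω ∧
        (fun p : Γ × Γ => ω (g⁻¹ * p.1, g⁻¹ * p.2)) ∈ A} →
      μ A = 0 ∨ μ A = μ (percOmega1 S))
    (D : ℝ) (hD : D = ∫ ω in percOmega1 S, (percDeg S ω 1 : ℝ) ∂μ)
    (μ' : Measure (Γ × Γ → Bool))
    (hμ' : μ' = μ.withDensity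
      (Set.indicator (percOmega1 S) (fun ω => ENNReal.ofReal ((percDeg S ω 1 : ℝ) / D))))
    (P : (Γ × Γ → Bool) → Measure (ℕ → Γ))
    (hPprob : ∀ ω, IsProbabilityMeasure (P ω))
    (hPmeas : Measurable P)
    (hPcyl : ∀ ω : Γ × Γ → Bool, ∀ n : ℕ, ∀ y : ℕ → Γ,
      P ω {x : ℕ → Γ | ∀ i ≤ n, x i = y i} =
        (if y 0 = 1 then 1 else 0) * ∏ i ∈ Finset.range n, percStep S ω (y i) (y (i + 1)))
    (lam : Measure ((Γ × Γ → Bool) × (ℕ → Γ)))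
    (hlam : lam = μ'.bind (fun ω => (Measure.dirac ω).prod (P ω)))
    (T : ((Γ × Γ → Bool) × (ℕ → Γ)) → ((Γ × Γ → Bool) × (ℕ → Γ)))
    (hT : T = fun p =>
      (fun q : Γ × Γ => p.1 (p.2 1 * q.1, p.2 1 * q.2),
        fun n : ℕ => (p.2 1)⁻¹ * p.2 (n + 1))) :
    MeasurePreserving T lam lam ∧
      ∀ A : Set ((Γ × Γ → Bool) × (ℕ → Γ)), MeasurableSet A → T ⁻¹' A = A →
        lam A = 0 ∨ lam A = 1 := by
  have hP : PWalk S P := ⟨hPprob, hPmeas, hPcyl⟩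
  have hO := measurableSet_percOmega1 (Γ := Γ) S
  have hinv' : ∀ g : Γ, μ.map (pAct g) = μ := fun g => by
    have := hinv g⁻¹
    simp only [inv_inv] at this
    exact this
  have hsym' : ∀ᵐ ω ∂μ, ω ∈ (pSym : Set (Γ × Γ → Bool)) := hsymm
  have hTU : T = pU 1 := by
    rw [hT]
    funext p
    simp only [pU, add_comm 1]
    rfl
  rw [hTU]
  have hdegm := measurable_percDeg (Γ := Γ) S
  have hDeq : ENNReal.ofReal D = ∫⁻ ω in percOmega1 S, (percDeg S ω 1 : ℝ≥0∞) ∂μ := by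
    have hr : Measurable (fun ω : Γ × Γ → Bool => (percDeg S ω 1 : ℝ)) := by
      have := hdegm.ennreal_toReal
      simpa using this
    rw [hD, ofReal_integral_eq_lintegral_ofReal]
    · simp
    · refine Integrable.of_bound hr.aestronglyMeasurable (S.card : ℝ) (ae_of_all _ fun ω => ?_)
      simp only [Real.norm_natCast, Nat.cast_le]
      exact Finset.card_filter_le _ _
    · exact ae_of_all _ fun ω => Nat.cast_nonneg _
  have hDpos : ENNReal.ofReal D ≠ 0 := by
    refine (lt_of_lt_of_le hpos ?_).ne'
    rw [hDeq, ← setLIntegral_one]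
    refine setLIntegral_mono hdegm fun ω hω => ?_
    exact_mod_cast percDeg_pos hω
  have hD0 : 0 < D := by
    by_contra h
    exact hDpos (ENNReal.ofReal_eq_zero.2 (not_lt.1 h))
  set c : ℝ≥0∞ := (ENNReal.ofReal D)⁻¹ with hc
  have hμ2 : μ' = (μ.restrict (percOmega1 S)).withDensity (fun ω => percDeg S ω 1 * c) := by
    rw [hμ', withDensity_indicator hO]
    congr 1
    funext ω
    rw [ENNReal.ofReal_div_of_pos hD0, ENNReal.ofReal_natCast, div_eq_mul_inv]
  have hwm : Measurable (fun ω : Γ × Γ → Bool => (percDeg S ω 1 : ℝ≥0∞) * c) :=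
    hdegm.mul_const c
  have hμI : ∀ f : (Γ × Γ → Bool) → ℝ≥0∞, Measurable f →
      ∫⁻ ω, f ω ∂μ' = ∫⁻ ω in percOmega1 S, (percDeg S ω 1 * c) * f ω ∂μ := fun f hf => by
    rw [hμ2, lintegral_withDensity_eq_lintegral_mul _ hwm hf]
    rfl
  have hμ1 : IsProbabilityMeasure μ' := by
    constructor
    rw [← lintegral_one, hμI _ measurable_const]
    simp only [mul_one]
    rw [lintegral_mul_const _ hdegm, ← hDeq, hc, ENNReal.mul_inv_cancel hDpos ENNReal.ofReal_ne_top]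
  have hac : μ' ≪ μ.restrict (percOmega1 S) := by
    rw [hμ2]; exact withDensity_absolutelyContinuous _ _
  let κ : ProbabilityTheory.Kernel (Γ × Γ → Bool) (ℕ → Γ) := ⟨P, hPmeas⟩
  have hκ : ProbabilityTheory.IsMarkovKernel κ := ⟨hPprob⟩
  have hbm : Measurable (fun ω : Γ × Γ → Bool => (Measure.dirac ω).prod (P ω)) := by
    have h1 : (fun ω : Γ × Γ → Bool => (Measure.dirac ω).prod (P ω)) =
        fun ω => (ProbabilityTheory.Kernel.prod ProbabilityTheory.Kernel.id κ) ω := by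
      funext ω
      rw [ProbabilityTheory.Kernel.prod_apply, ProbabilityTheory.Kernel.id_apply]
      rfl
    rw [h1]
    exact ProbabilityTheory.Kernel.measurable _
  have hlamI : ∀ F : (Γ × Γ → Bool) × (ℕ → Γ) → ℝ≥0∞, Measurable F →
      ∫⁻ p, F p ∂lam = ∫⁻ ω, ∫⁻ x, F (ω, x) ∂(P ω) ∂μ' := fun F hF => by
    rw [hlam, Measure.lintegral_bind hbm.aemeasurable hF.aemeasurable]
    refine lintegral_congr fun ω => ?_
    rw [Measure.dirac_prod, lintegral_map hF measurable_prodMk_left]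
  have hlamA : ∀ A : Set ((Γ × Γ → Bool) × (ℕ → Γ)), MeasurableSet A →
      lam A = ∫⁻ ω, pH P A ω ∂μ' := fun A hA => by
    rw [← lintegral_indicator_one hA, hlamI _ (measurable_one.indicator hA)]
    refine lintegral_congr fun ω => ?_
    rw [pH, ← lintegral_indicator_one (measurable_prodMk_left hA)]
    rfl
  have hlam1 : IsProbabilityMeasure lam := by
    constructor
    rw [hlamA _ MeasurableSet.univ]
    simp [pH]
  have hmp : MeasurePreserving (pU 1) lam lam := by
    refine ⟨measurable_pU 1, ?_⟩
    ext A hA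
    rw [Measure.map_apply (measurable_pU 1) hA, hlamA _ hA, hlamA _ (measurable_pU 1 hA),
      hμI _ (hP.measurable_pH hA), hμI _ (hP.measurable_pH (measurable_pU 1 hA)),
      ← pMuInv hSsymm hP μ hinv' hsym' c _ (hP.measurable_pH hA)]
    refine lintegral_congr fun ω => ?_
    have := hP.markov_set hA ω 1 Set.univ
    simp only [Set.preimage_univ, Set.univ_inter, Measure.restrict_univ] at this
    rw [← this]
    rfl
  refine ⟨hmp, fun A hA hAT => ?_⟩
  have hAT' : pU 1 ⁻¹' Aᶜ = Aᶜ := by rw [Set.preimage_compl, hAT]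
  have hz := hP.zero_one hlamI hmp hA hAT
  have hzm : Measurable (fun ω => pH P A ω * pH P Aᶜ ω) :=
    (hP.measurable_pH hA).mul (hP.measurable_pH hA.compl)
  rw [lintegral_eq_zero_iff hzm] at hz
  set B : Set (Γ × Γ → Bool) := percOmega1 S ∩ (pSym ∩ pH P Aᶜ ⁻¹' {0}) with hB
  have hBm : MeasurableSet B :=
    hO.inter (measurableSet_pSym.inter (hP.measurable_pH hA.compl (measurableSet_singleton 0)))
  have hsymμ' : ∀ᵐ ω ∂μ', ω ∈ (pSym : Set (Γ × Γ → Bool)) :=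
    hac.ae_le (ae_restrict_of_ae hsym')
  have hOμ' : ∀ᵐ ω ∂μ', ω ∈ percOmega1 S := hac.ae_le (ae_restrict_mem hO)
  have hsat : B = {ω ∈ percOmega1 S | ∃ g : Γ, g⁻¹ ∈ percCluster S ω ∧
      (fun p : Γ × Γ => ω (g⁻¹ * p.1, g⁻¹ * p.2)) ∈ B} := by
    ext ω
    constructor
    · intro hω
      refine ⟨hω.1, 1, ?_, ?_⟩
      · rw [inv_one]; exact Relation.ReflTransGen.refl
      · simpa using hω
    · rintro ⟨h1, g, hg, h2, h3, h4⟩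
      change pAct g⁻¹ ω ∈ pSym at h3
      change pH P Aᶜ (pAct g⁻¹ ω) = 0 at h4
      have hωs : ω ∈ (pSym : Set (Γ × Γ → Bool)) := by
        have := pSym_pAct h3 g
        rwa [pAct_pAct, inv_mul_cancel, pAct_one] at this
      exact ⟨h1, hωs, hP.harm_path hA.compl hSsymm hAT' hωs hg h4⟩
  rcases hind B hBm Set.inter_subset_left hsat with h | h
  · left
    rw [hlamA A hA, lintegral_eq_zero_iff (hP.measurable_pH hA)]
    have hnB : ∀ᵐ ω ∂μ', ω ∉ B := hac.ae_le (ae_restrict_of_ae (measure_eq_zero_iff_ae_notMem.1 h))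
    filter_upwards [hnB, hsymμ', hOμ', hz] with ω h1 h2 h3 h4
    exact (mul_eq_zero.1 h4).resolve_right fun h5 => h1 ⟨h3, h2, h5⟩
  · right
    rw [← prob_compl_eq_zero_iff hA, hlamA _ hA.compl,
      lintegral_eq_zero_iff (hP.measurable_pH hA.compl)]
    have hd : μ (percOmega1 S \ B) = 0 := by
      rw [measure_sdiff Set.inter_subset_left hBm.nullMeasurableSet (measure_ne_top _ _), h,
        tsub_self]
    have hnB : ∀ᵐ ω ∂μ', ω ∉ percOmega1 S \ B :=
      hac.ae_le (ae_restrict_of_ae (measure_eq_zero_iff_ae_notMem.1 hd))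
    filter_upwards [hnB, hOμ'] with ω h1 h2
    by_contra h3
    exact h1 ⟨h2, fun h4 => h3 h4.2.2⟩
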